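/- (Optimality of the hexagonal grid) For angles θ₁, θ₂ with sin(θ₂ − θ₁) ≠ 0, define α = (cos²θ₁ + cos θ₁ cos θ₂ + cos²θ₂)/|sin(θ₂−θ₁)|, β = (sin²θ₁ + sin θ₁ sin θ₂ + sin²θ₂)/|sin(θ₂−θ₁)|, γ = (sin 2θ₁ + sin(θ₁+θ₂) + sin 2θ₂)/|sin(θ₂−θ₁)|, and C(θ₁,θ₂) = (α² + β² + γ²)^{1/2}. Then C(θ₁,θ₂) ≥ √(3/2) for all such θ₁, θ₂, and equality holds if and only if cos(θ₂ − θ₁) = −1/2, i.e., if and only if θ₂ − θ₁ ≡ 2π/3 or 4π/3 (mod 2π), which corresponds to a hexagonal grid. -/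

import Mathlib

open Real

noncomputable def alph (θ₁ θ₂ : ℝ) : ℝ :=
  (Real.cos θ₁ ^ 2 + Real.cos θ₁ * Real.cos θ₂ + Real.cos θ₂ ^ 2) / |Real.sin (θ₂ - θ₁)|

noncomputable def bet (θ₁ θ₂ : ℝ) : ℝ :=
  (Real.sin θ₁ ^ 2 + Real.sin θ₁ * Real.sin θ₂ + Real.sin θ₂ ^ 2) / |Real.sin (θ₂ - θ₁)|

noncomputable def gam (θ₁ θ₂ : ℝ) : ℝ :=
  (Real.sin (2 * θ₁) + Real.sin (θ₁ + θ₂) + Real.sin (2 * θ₂)) / |Real.sin (θ₂ - θ₁)|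

/-- The asymptotic error constant `C(θ₁,θ₂) = (α² + β² + γ²)^{1/2}`. -/
noncomputable def errConst (θ₁ θ₂ : ℝ) : ℝ :=
  Real.sqrt ((alph θ₁ θ₂) ^ 2 + (bet θ₁ θ₂) ^ 2 + (gam θ₁ θ₂) ^ 2)

/-- The Gram-type identity expressing `C² - 3/2` through `1 + 2 cos (θ₂ - θ₁)` and `γ`. -/
theorem sq_sum_sub_eq (θ₁ θ₂ : ℝ) (hsin : Real.sin (θ₂ - θ₁) ≠ 0) :
    alph θ₁ θ₂ ^ 2 + bet θ₁ θ₂ ^ 2 + gam θ₁ θ₂ ^ 2 =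
      3 / 2 + (2 * Real.cos (θ₂ - θ₁) + 1) ^ 2 / Real.sin (θ₂ - θ₁) ^ 2 + gam θ₁ θ₂ ^ 2 / 2 := by
  have hs := Real.sin_sq_add_cos_sq (θ₂ - θ₁)
  have h₁ := Real.sin_sq_add_cos_sq θ₁
  have h₂ := Real.sin_sq_add_cos_sq θ₂
  unfold alph bet gam
  simp only [div_pow, sq_abs, Real.sin_two_mul, Real.sin_add]
  field_simp
  have hc : Real.cos (θ₂ - θ₁) = _ := Real.cos_sub _ _
  have hS : Real.sin (θ₂ - θ₁) = _ := Real.sin_sub _ _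
  generalize Real.sin (θ₂ - θ₁) = s at *
  generalize Real.cos (θ₂ - θ₁) = c at *
  generalize Real.sin θ₁ = x at *
  generalize Real.cos θ₁ = y at *
  generalize Real.sin θ₂ = z at *
  generalize Real.cos θ₂ = w at *
  have hT : (y ^ 2 + y * w + w ^ 2) + (x ^ 2 + x * z + z ^ 2) = 2 + c := by
    rw [hc]; linear_combination h₁ + h₂
  have hdet : 4 * (y ^ 2 + y * w + w ^ 2) * (x ^ 2 + x * z + z ^ 2) =
      (2 * x * y + (x * w + y * z) + 2 * z * w) ^ 2 + 3 * s ^ 2 := by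
    rw [hS]; ring
  linear_combination
    2 * ((y ^ 2 + y * w + w ^ 2) + (x ^ 2 + x * z + z ^ 2) + (2 + c)) * hT - hdet - 6 * hs

/-- At an angle of cosine `-1/2` the off-diagonal term vanishes. -/
theorem gam_eq_zero (θ₁ θ₂ : ℝ) (hcos : Real.cos (θ₂ - θ₁) = -(1 / 2)) : gam θ₁ θ₂ = 0 := by
  have h : Real.sin (2 * θ₁) + Real.sin (2 * θ₂) =
      2 * Real.sin (θ₁ + θ₂) * Real.cos (θ₂ - θ₁) := by
    rw [show 2 * θ₁ = (θ₁ + θ₂) - (θ₂ - θ₁) by ring,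
      show 2 * θ₂ = (θ₁ + θ₂) + (θ₂ - θ₁) by ring, Real.sin_sub (θ₁ + θ₂),
      Real.sin_add (θ₁ + θ₂)]
    ring
  rw [hcos] at h
  rw [gam, div_eq_zero_iff]
  left
  linarith

theorem cos_eq_neg_half_iff (x : ℝ) :
    Real.cos x = -(1 / 2) ↔
      ∃ k : ℤ, x = 2 * π / 3 + 2 * π * k ∨ x = 4 * π / 3 + 2 * π * k := by
  have h : Real.cos (2 * π / 3) = -(1 / 2) := by
    rw [show 2 * π / 3 = π - π / 3 by ring, Real.cos_pi_sub, Real.cos_pi_div_three]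
  rw [← h, eq_comm, Real.cos_eq_cos_iff]
  constructor
  · rintro ⟨k, hk | hk⟩
    · exact ⟨k, Or.inl (by linarith)⟩
    · refine ⟨k - 1, Or.inr ?_⟩
      push_cast
      linarith
  · rintro ⟨k, hk | hk⟩
    · exact ⟨k, Or.inl (by linarith)⟩
    · refine ⟨k + 1, Or.inr ?_⟩
      push_cast
      linarith

/-- Optimality of the hexagonal grid: `C(θ₁,θ₂) ≥ √(3/2)`, with equality iff
`cos(θ₂ − θ₁) = −1/2`, i.e. iff `θ₂ − θ₁ ≡ 2π/3` or `4π/3 (mod 2π)` (hexagonal grid). -/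
theorem errConst_ge_hexagonal (θ₁ θ₂ : ℝ) (hsin : Real.sin (θ₂ - θ₁) ≠ 0) :
    Real.sqrt (3 / 2) ≤ errConst θ₁ θ₂ ∧
    (errConst θ₁ θ₂ = Real.sqrt (3 / 2) ↔ Real.cos (θ₂ - θ₁) = -(1 / 2)) ∧
    (Real.cos (θ₂ - θ₁) = -(1 / 2) ↔
      ∃ k : ℤ, θ₂ - θ₁ = 2 * π / 3 + 2 * π * k ∨ θ₂ - θ₁ = 4 * π / 3 + 2 * π * k) := by
  have hid := sq_sum_sub_eq θ₁ θ₂ hsin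
  have hq : 0 ≤ (2 * Real.cos (θ₂ - θ₁) + 1) ^ 2 / Real.sin (θ₂ - θ₁) ^ 2 := by positivity
  refine ⟨Real.sqrt_le_sqrt ?_, ⟨fun h => ?_, fun h => ?_⟩, cos_eq_neg_half_iff _⟩
  · nlinarith [sq_nonneg (gam θ₁ θ₂)]
  · rw [errConst, Real.sqrt_inj (by positivity) (by norm_num)] at h
    have hz : (2 * Real.cos (θ₂ - θ₁) + 1) ^ 2 / Real.sin (θ₂ - θ₁) ^ 2 = 0 := by
      nlinarith [sq_nonneg (gam θ₁ θ₂)]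
    have h_sq := (div_eq_zero_iff.mp hz).resolve_right (pow_ne_zero 2 hsin)
    linarith [pow_eq_zero_iff two_ne_zero |>.mp h_sq]
  · rw [errConst, hid, gam_eq_zero _ _ h, h]
    norm_num
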